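/- arXiv:1105.4732 — 8 statements merged into one kernel-verified Lean document; each statement's English description precedes it below -/
import Mathlib

section
/- Let V and W be finite-dimensional complex normed vector spaces and let Λ ⊆ V be a lattice. Suppose δ : V → W is holomorphic (differentiable over ℂ on all of V) and for every λ ∈ Λ the function z ↦ δ(z+λ) − δ(z) is constant on V. Then δ is affine: there exists a continuous ℂ-linear map L : V → W such that δ(z) = δ(0) + L(z) for all z ∈ V. -/
/-- A holomorphic map that is periodic with respect to a full lattice is constant. -/
theorem Differentiable.apply_eq_apply_of_zlattice_periodic
    {V W : Type*}
    [NormedAddCommGroup V] [NormedSpace ℂ V] [FiniteDimensional ℂ V]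
    [NormedAddCommGroup W] [NormedSpace ℂ W]
    (Λ : Submodule ℤ V) [DiscreteTopology Λ] [IsZLattice ℝ Λ]
    {f : V → W} (hf : Differentiable ℂ f) (hper : ∀ z, ∀ v ∈ Λ, f (z + v) = f z) (z w : V) :
    f z = f w := by
  have : FiniteDimensional ℝ V := FiniteDimensional.complexToReal V
  exact hf.apply_eq_apply_of_bounded
    (IsZLattice.isCompact_range_of_periodic Λ f hf.continuous hper).isBounded z w


/-- A holomorphic map between finite-dimensional complex normed
vector spaces whose increments `δ (z + λ) - δ z` are constant for every element
`λ` of a lattice `Λ ⊆ V` is affine. -/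
theorem stmt_0
    (V W : Type*)
    [NormedAddCommGroup V] [NormedSpace ℂ V] [FiniteDimensional ℂ V]
    [NormedAddCommGroup W] [NormedSpace ℂ W] [FiniteDimensional ℂ W]
    (Λ : AddSubgroup V)
    (hdisc : DiscreteTopology Λ)
    (hspan : Submodule.span ℝ (Λ : Set V) = ⊤)
    (δ : V → W)
    (hδ : Differentiable ℂ δ)
    (hper : ∀ lam ∈ Λ, ∀ z w : V, δ (z + lam) - δ z = δ (w + lam) - δ w) :
    ∃ L : V →L[ℂ] W, ∀ z : V, δ z = δ 0 + L z := by
  have hdisc' : DiscreteTopology Λ.toIntSubmodule := hdisc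
  have hlat : IsZLattice ℝ Λ.toIntSubmodule := ⟨hspan⟩
  have hadd : ∀ z w : V, δ (z + w) - δ z = δ w - δ 0 := by
    intro z w
    have hdiff : Differentiable ℂ fun x => δ (x + w) - δ x :=
      (hδ.comp (differentiable_id.add_const w)).sub hδ
    have key := hdiff.apply_eq_apply_of_zlattice_periodic Λ.toIntSubmodule (fun x v hv => by
      have h := hper v hv (x + w) x
      rw [sub_eq_sub_iff_sub_eq_sub] at h
      rwa [add_right_comm x v w]) z 0
    simpa using key
  let g : V →+ W := AddMonoidHom.mk' (fun z => δ z - δ 0) fun z w => by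
    rw [← hadd z w]
    abel
  let G : V →L[ℝ] W := g.toRealLinearMap (hδ.continuous.sub continuous_const)
  refine ⟨fderiv ℂ δ 0, fun z => ?_⟩
  have hderiv : HasFDerivAt (G : V → W) ((fderiv ℂ δ 0).restrictScalars ℝ) 0 :=
    ((hδ 0).hasFDerivAt.restrictScalars ℝ).sub_const (δ 0)
  have hG : (fderiv ℂ δ 0) z = δ z - δ 0 :=
    congrArg (fun T : V →L[ℝ] W => T z) (hderiv.unique G.hasFDerivAt)
  rw [hG, add_sub_cancel]
end

section
/- Let Λ be a lattice in ℂ. Suppose δ : ℂ → ℂ is holomorphic and nowhere zero, and there is a function h : Λ → ℂ such that δ(z+λ) = h(λ)·δ(z) for all z ∈ ℂ and all λ ∈ Λ. Then there exist C ∈ ℂ with C ≠ 0 and a ∈ ℂ such that δ(z) = C·exp(a·z) for all z ∈ ℂ, and h(λ) = exp(a·λ) for all λ ∈ Λ. (This classifies all ℂ×-structures on elliptic curves.) -/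
/-- An additive subgroup spanning a finite-dimensional real space has a bounded set of
representatives for its cosets. -/
theorem AddSubgroup.exists_isBounded_sub_mem_of_span_eq_top {E : Type*} [NormedAddCommGroup E]
    [NormedSpace ℝ E] [FiniteDimensional ℝ E] (Λ : AddSubgroup E)
    (hspan : Submodule.span ℝ (Λ : Set E) = ⊤) :
    ∃ K : Set E, Bornology.IsBounded K ∧ ∀ z, ∃ lam ∈ Λ, z - lam ∈ K := by
  let b := Module.Basis.ofSpan hspan.ge
  have : Finite _ := Module.Finite.finite_basis b
  refine ⟨ZSpan.fundamentalDomain b, ZSpan.fundamentalDomain_isBounded b, fun z => ?_⟩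
  refine ⟨ZSpan.floor b z, ?_, ZSpan.fract_mem_fundamentalDomain b z⟩
  have hle : Submodule.span ℤ (Set.range b) ≤ AddSubgroup.toIntSubmodule Λ :=
    Submodule.span_le.2 (Module.Basis.ofSpan_subset hspan.ge)
  exact hle (ZSpan.floor b z).2

/-- A continuous function invariant under a subgroup spanning the (finite-dimensional) space
is bounded. -/
theorem Continuous.isBounded_range_of_invariant {E F : Type*} [NormedAddCommGroup E]
    [NormedSpace ℝ E] [FiniteDimensional ℝ E] [PseudoMetricSpace F] {f : E → F}
    (hf : Continuous f) (Λ : AddSubgroup E) (hspan : Submodule.span ℝ (Λ : Set E) = ⊤)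
    (hinv : ∀ z, ∀ lam ∈ Λ, f (z + lam) = f z) : Bornology.IsBounded (Set.range f) := by
  obtain ⟨K, hK, hcov⟩ := Λ.exists_isBounded_sub_mem_of_span_eq_top hspan
  have : ProperSpace E := FiniteDimensional.proper_real E
  refine ((hK.isCompact_closure.image hf).isBounded).subset ?_
  rintro _ ⟨z, rfl⟩
  obtain ⟨lam, hlam, hmem⟩ := hcov z
  exact ⟨z - lam, subset_closure hmem, by rw [← hinv _ lam hlam, sub_add_cancel]⟩

/-- A function with constant logarithmic derivative is an exponential. -/
theorem Complex.eq_mul_exp_of_deriv_eq {f : ℂ → ℂ} (hf : Differentiable ℂ f) {a : ℂ}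
    (ha : ∀ z, deriv f z = a * f z) (z : ℂ) : f z = f 0 * Complex.exp (a * z) := by
  have hd : ∀ w, HasDerivAt (fun w => f w * Complex.exp (-(a * w))) 0 w := fun w => by
    have hexp : HasDerivAt (fun w => Complex.exp (-(a * w))) (Complex.exp (-(a * w)) * -(a * 1)) w :=
      ((hasDerivAt_id w).const_mul a).neg.cexp
    refine ((hf w).hasDerivAt.mul hexp).congr_deriv ?_
    rw [ha]
    ring
  have hc := is_const_of_deriv_eq_zero (fun w => (hd w).differentiableAt)
    (fun w => (hd w).deriv) z 0
  simp only [mul_zero, neg_zero, Complex.exp_zero, mul_one] at hc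
  rw [← hc, mul_assoc, ← Complex.exp_add, neg_add_cancel, Complex.exp_zero, mul_one]

/-- a nowhere-zero holomorphic `δ : ℂ → ℂ` satisfying
`δ (z + λ) = h λ * δ z` for all `λ` in a lattice `Λ` is `C * exp (a z)`,
and `h λ = exp (a λ)` on `Λ`. -/
theorem stmt_2
    (Λ : AddSubgroup ℂ)
    (hdisc : DiscreteTopology Λ)
    (hspan : Submodule.span ℝ (Λ : Set ℂ) = ⊤)
    (δ : ℂ → ℂ)
    (hδ : Differentiable ℂ δ)
    (hδ0 : ∀ z : ℂ, δ z ≠ 0)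
    (h : ℂ → ℂ)
    (hper : ∀ z : ℂ, ∀ lam ∈ Λ, δ (z + lam) = h lam * δ z) :
    ∃ C a : ℂ, C ≠ 0 ∧ (∀ z : ℂ, δ z = C * Complex.exp (a * z)) ∧
      ∀ lam ∈ Λ, h lam = Complex.exp (a * lam) := by
  have hdiff : Differentiable ℂ fun z => deriv δ z / δ z :=
    hδ.deriv.div hδ hδ0
  have hinv : ∀ z, ∀ lam ∈ Λ, deriv δ (z + lam) / δ (z + lam) = deriv δ z / δ z := by
    intro z lam hlam
    have hne : h lam ≠ 0 := fun h0 => hδ0 (z + lam) (by rw [hper z lam hlam, h0, zero_mul])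
    have hderiv : deriv δ (z + lam) = h lam * deriv δ z := by
      rw [← deriv_comp_add_const, funext fun w => hper w lam hlam, deriv_const_mul _ (hδ z)]
    rw [hderiv, hper z lam hlam, mul_div_mul_left _ _ hne]
  obtain ⟨a, ha⟩ := hdiff.exists_const_forall_eq_of_bounded
    (hdiff.continuous.isBounded_range_of_invariant Λ hspan hinv)
  have hexp := Complex.eq_mul_exp_of_deriv_eq hδ fun z => (div_eq_iff (hδ0 z)).1 (ha z)
  refine ⟨δ 0, a, hδ0 0, hexp, fun lam hlam => mul_right_cancel₀ (hδ0 0) ?_⟩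
  rw [← hper 0 lam hlam, zero_add, hexp lam, mul_comm]
end

section
/- Let Λ be a lattice in ℂ and let n be a positive integer. Suppose δ : ℂ → ℂ is holomorphic with nowhere-vanishing derivative, and a : Λ → ℂ, b : Λ → ℂ are functions such that a(λ)^n = 1 and δ(z+λ) = a(λ)·δ(z) + b(λ) for all z ∈ ℂ and all λ ∈ Λ. Then there exist c, d ∈ ℂ with c ≠ 0 such that δ(z) = c·z + d for all z ∈ ℂ, and a(λ) = 1 and b(λ) = c·λ for all λ ∈ Λ. (This classifies all (ℤₙ ⋉ ℂ/Λ₀)/ℤₙ-structures on elliptic curves: every developing map is affine-linear.) -/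
/-- An additive subgroup spanning a finite-dimensional real normed space is cobounded: every
vector can be translated by an element of the subgroup into a fixed closed ball. -/
theorem AddSubgroup.exists_norm_add_le_of_span_eq_top {E : Type*} [NormedAddCommGroup E]
    [NormedSpace ℝ E] [FiniteDimensional ℝ E] (L : AddSubgroup E)
    (hspan : Submodule.span ℝ (L : Set E) = ⊤) :
    ∃ R : ℝ, ∀ z : E, ∃ l ∈ L, ‖z + l‖ ≤ R := by
  obtain ⟨t, htL, hts, hli⟩ := exists_linearIndependent ℝ (L : Set E)
  have : Fintype t := hli.setFinite.fintype
  let B : Module.Basis t ℝ E := Module.Basis.mk hli (by simp [hts, hspan])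
  refine ⟨∑ i, ‖B i‖, fun z => ⟨-(ZSpan.floor B z : E), L.neg_mem ?_, ?_⟩⟩
  · have hle : Submodule.span ℤ (Set.range B) ≤ AddSubgroup.toIntSubmodule L := by
      rw [Submodule.span_le]
      rintro _ ⟨i, rfl⟩
      simpa [B] using htL i.2
    exact hle (ZSpan.floor B z).2
  · simpa [ZSpan.fract_apply, sub_eq_add_neg] using ZSpan.norm_fract_le B z

/-- An entire function whose norm is invariant under a spanning subgroup of `ℂ` is constant. -/
theorem Differentiable.exists_eq_const_of_norm_add_eq {f : ℂ → ℂ} (hf : Differentiable ℂ f)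
    (L : AddSubgroup ℂ) (hspan : Submodule.span ℝ (L : Set ℂ) = ⊤)
    (hper : ∀ z, ∀ l ∈ L, ‖f (z + l)‖ = ‖f z‖) : ∃ c, ∀ z, f z = c := by
  obtain ⟨R, hR⟩ := L.exists_norm_add_le_of_span_eq_top hspan
  obtain ⟨C, hC⟩ :=
    (isCompact_closedBall (0 : ℂ) R).exists_bound_of_continuousOn hf.continuous.continuousOn
  refine hf.exists_const_forall_eq_of_bounded (isBounded_iff_forall_norm_le.2 ⟨C, ?_⟩)
  rintro _ ⟨z, rfl⟩
  obtain ⟨l, hl, hzl⟩ := hR z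
  rw [← hper z l hl]
  exact hC _ (by simpa using hzl)

/-- a holomorphic `δ : ℂ → ℂ` with nowhere-vanishing derivative
satisfying `δ (z + λ) = a λ * δ z + b λ` with `a λ` an `n`-th root of unity,
for all `λ` in a lattice `Λ`, is affine-linear `δ z = c z + d`, with
`a λ = 1` and `b λ = c λ` on `Λ`. -/
theorem stmt_3
    (Λ : AddSubgroup ℂ)
    (hdisc : DiscreteTopology Λ)
    (hspan : Submodule.span ℝ (Λ : Set ℂ) = ⊤)
    (n : ℕ) (hn : 0 < n)
    (δ : ℂ → ℂ)
    (hδ : Differentiable ℂ δ)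
    (hδ' : ∀ z : ℂ, deriv δ z ≠ 0)
    (a b : ℂ → ℂ)
    (ha : ∀ lam ∈ Λ, a lam ^ n = 1)
    (hper : ∀ z : ℂ, ∀ lam ∈ Λ, δ (z + lam) = a lam * δ z + b lam) :
    ∃ c d : ℂ, c ≠ 0 ∧ (∀ z : ℂ, δ z = c * z + d) ∧
      ∀ lam ∈ Λ, a lam = 1 ∧ b lam = c * lam := by
  have hderiv : ∀ z : ℂ, ∀ l ∈ Λ, deriv δ (z + l) = a l * deriv δ z := by
    intro z l hl
    rw [← deriv_comp_add_const, funext fun w => hper w l hl, deriv_add_const,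
      deriv_const_mul _ (hδ z)]
  obtain ⟨c, hc⟩ := hδ.deriv.exists_eq_const_of_norm_add_eq Λ hspan fun z l hl => by
    rw [hderiv z l hl, norm_mul, Complex.norm_eq_one_of_pow_eq_one (ha l hl) hn.ne', one_mul]
  have hc0 : c ≠ 0 := hc 0 ▸ hδ' 0
  have hlin : ∀ z, δ z = c * z + δ 0 := by
    intro z
    have hconst := is_const_of_deriv_eq_zero (f := fun w => δ w - c * w)
      (hδ.sub (differentiable_id.const_mul c)) (fun w => by
        have h := ((hδ w).hasDerivAt.sub ((hasDerivAt_id w).const_mul c)).deriv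
        rw [hc w, mul_one, sub_self] at h
        exact h) z 0
    simp only [mul_zero, sub_zero] at hconst
    linear_combination hconst
  refine ⟨c, δ 0, hc0, hlin, fun l hl => ?_⟩
  have ha1 : a l = 1 := by
    have h := hderiv 0 l hl
    rw [hc, hc] at h
    exact mul_right_cancel₀ hc0 (by rw [one_mul, ← h])
  refine ⟨ha1, ?_⟩
  have h := hper 0 l hl
  rw [ha1, zero_add, hlin l] at h
  linear_combination -h
end

section
/- Let Λ be a lattice in ℂ. Suppose δ : ℂ → ℂ is holomorphic, nowhere zero, with nowhere-vanishing derivative, and for each λ ∈ Λ one of the following holds: either there exists a ∈ ℂ with δ(z+λ) = a·δ(z) for all z ∈ ℂ, or there exists a ∈ ℂ with δ(z+λ)·δ(z) = a for all z ∈ ℂ. Then there exist C, c ∈ ℂ, both nonzero, such that δ(z) = C·exp(c·z) for all z ∈ ℂ and δ(z+λ) = exp(c·λ)·δ(z) for all z ∈ ℂ and all λ ∈ Λ; in particular the first alternative holds for every λ ∈ Λ. (This classifies all (ℤ₂ ⋉ ℂ×)/ℤ₂-structures on compact complex curves.) -/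
/-- A differentiable function invariant under the translations by a set spanning `ℂ` over `ℝ` is
constant. -/
theorem Differentiable.apply_eq_apply_of_periodic_of_span_eq_top {S : AddSubgroup ℂ}
    (hspan : Submodule.span ℝ (S : Set ℂ) = ⊤) {g : ℂ → ℂ} (hg : Differentiable ℂ g)
    (hper : ∀ l ∈ S, ∀ z, g (z + l) = g z) (z w : ℂ) : g z = g w := by
  have htop : ⊤ ≤ Submodule.span ℝ (S : Set ℂ) := hspan.ge
  let b := Module.Basis.ofSpan htop
  have : Finite _ := Module.Finite.finite_basis b
  have hb : Submodule.span ℤ (Set.range b) ≤ S.toIntSubmodule := by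
    rw [Submodule.span_le]
    exact Module.Basis.ofSpan_subset htop
  have hfract : ∀ x, g x = g (ZSpan.fract b x) := fun x ↦ by
    have h := hper _ (hb (ZSpan.floor b x).2) (ZSpan.fract b x)
    rw [← h, ZSpan.fract_apply, sub_add_cancel]
  have hcpt : IsCompact (closure (ZSpan.fundamentalDomain b)) :=
    (ZSpan.fundamentalDomain_isBounded b).isCompact_closure
  refine hg.apply_eq_apply_of_bounded ?_ z w
  refine (hcpt.image hg.continuous).isBounded.subset ?_
  rintro _ ⟨x, rfl⟩
  exact ⟨_, subset_closure (ZSpan.fract_mem_fundamentalDomain b x), (hfract x).symm⟩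

/-- The square of the logarithmic derivative is unchanged by a translation that multiplies a
function by a constant, or sends it to a constant multiple of its inverse. -/
theorem sq_logDeriv_add_eq {δ : ℂ → ℂ} (hδ : Differentiable ℂ δ) (hδ0 : ∀ z, δ z ≠ 0) {l : ℂ}
    (h : (∃ a : ℂ, ∀ z : ℂ, δ (z + l) = a * δ z) ∨ (∃ a : ℂ, ∀ z : ℂ, δ (z + l) * δ z = a))
    (z : ℂ) : (deriv δ (z + l) / δ (z + l)) ^ 2 = (deriv δ z / δ z) ^ 2 := by
  have hz := hδ0 z
  have hzl := hδ0 (z + l)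
  have hd : HasDerivAt (fun w ↦ δ (w + l)) (deriv δ (z + l)) z :=
    (hδ (z + l)).hasDerivAt.comp_add_const z l
  have hd' : HasDerivAt δ (deriv δ z) z := (hδ z).hasDerivAt
  rcases h with ⟨a, ha⟩ | ⟨a, ha⟩
  · have hder : deriv δ (z + l) = a * deriv δ z := by
      rw [funext ha] at hd
      exact hd.unique (hd'.const_mul a)
    have ha0 : a ≠ 0 := fun h0 ↦ hzl (by rw [ha, h0, zero_mul])
    rw [hder, ha, mul_div_mul_left _ _ ha0]
  · have hder : deriv δ (z + l) * δ z + δ (z + l) * deriv δ z = 0 := by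
      have hm := hd.fun_mul hd'
      rw [funext ha] at hm
      exact hm.unique (hasDerivAt_const z a)
    have hneg : deriv δ (z + l) / δ (z + l) = -(deriv δ z / δ z) := by
      field_simp
      linear_combination hder
    rw [hneg, neg_sq]

/-- A differentiable function whose square is constant has zero derivative. -/
theorem deriv_eq_zero_of_sq_eq {f : ℂ → ℂ} (hf : Differentiable ℂ f) (hf0 : ∀ z, f z ≠ 0)
    {k : ℂ} (h : ∀ z, f z ^ 2 = k) (z : ℂ) : deriv f z = 0 := by
  have hd := (hf z).hasDerivAt.fun_pow 2
  rw [funext h] at hd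
  simpa [hf0 z] using hd.unique (hasDerivAt_const z k)


/-- classification of `(ℤ₂ ⋉ ℂ×)/ℤ₂`-structures on elliptic
curves: a nowhere-zero holomorphic `δ` with nowhere-vanishing derivative such
that for each lattice element `λ` either `δ (z + λ) = a δ z` or
`δ (z + λ) δ z = a`, must be `C exp (c z)` and the first alternative holds
for every `λ`, with multiplier `exp (c λ)`. -/
theorem stmt_4
    (Λ : AddSubgroup ℂ)
    (hdisc : DiscreteTopology Λ)
    (hspan : Submodule.span ℝ (Λ : Set ℂ) = ⊤)
    (δ : ℂ → ℂ)
    (hδ : Differentiable ℂ δ)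
    (hδ0 : ∀ z : ℂ, δ z ≠ 0)
    (hδ' : ∀ z : ℂ, deriv δ z ≠ 0)
    (hper : ∀ lam ∈ Λ,
      (∃ a : ℂ, ∀ z : ℂ, δ (z + lam) = a * δ z) ∨
      (∃ a : ℂ, ∀ z : ℂ, δ (z + lam) * δ z = a)) :
    ∃ C c : ℂ, C ≠ 0 ∧ c ≠ 0 ∧ (∀ z : ℂ, δ z = C * Complex.exp (c * z)) ∧
      ∀ lam ∈ Λ, ∀ z : ℂ, δ (z + lam) = Complex.exp (c * lam) * δ z := by
  have hf : Differentiable ℂ fun z ↦ deriv δ z / δ z :=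
    hδ.deriv.fun_div hδ hδ0
  have hf0 : ∀ z, deriv δ z / δ z ≠ 0 := fun z ↦ div_ne_zero (hδ' z) (hδ0 z)
  have hsq : ∀ z, (deriv δ z / δ z) ^ 2 = (deriv δ 0 / δ 0) ^ 2 := fun z ↦
    (hf.fun_pow 2).apply_eq_apply_of_periodic_of_span_eq_top hspan
      (fun l hl ↦ sq_logDeriv_add_eq hδ hδ0 (hper l hl)) z 0
  obtain ⟨c, hc⟩ : ∃ c, ∀ z, deriv δ z / δ z = c :=
    ⟨_, fun z ↦ is_const_of_deriv_eq_zero hf (deriv_eq_zero_of_sq_eq hf hf0 hsq) z 0⟩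
  have hexp : ∀ z, δ z = δ 0 * Complex.exp (c * z) := fun z ↦ by
    have hd : ∀ w, HasDerivAt (fun w ↦ δ w * Complex.exp (-(c * w))) 0 w := fun w ↦ by
      have he := (((hasDerivAt_id w).const_mul c).fun_neg).cexp
      refine ((hδ w).hasDerivAt.fun_mul he).congr_deriv ?_
      rw [(div_eq_iff (hδ0 w)).1 (hc w)]
      simp only [id]
      ring
    have h := is_const_of_deriv_eq_zero (fun w ↦ (hd w).differentiableAt)
      (fun w ↦ (hd w).deriv) z 0
    simp only [mul_zero, neg_zero, Complex.exp_zero, mul_one] at h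
    rw [← h, mul_assoc, ← Complex.exp_add, neg_add_cancel, Complex.exp_zero, mul_one]
  refine ⟨δ 0, c, hδ0 0, hc 0 ▸ hf0 0, hexp, fun l _ z ↦ ?_⟩
  rw [hexp (z + l), hexp z, mul_add, Complex.exp_add]
  ring
end

section
/- Let Λ be a lattice in ℂ. Suppose δ : ℂ → ℂ is holomorphic with nowhere-vanishing derivative, and a : Λ → ℂ, t : Λ → ℂ are functions with a(λ) ≠ 0 and δ(z+λ) = a(λ)·δ(z) + t(λ) for all z ∈ ℂ and all λ ∈ Λ. Then exactly one of the following holds: either there exist α, β ∈ ℂ with α ≠ 0 such that δ(z) = α·z + β for all z and a(λ) = 1 for all λ ∈ Λ; or there exist k, c ∈ ℂ, both nonzero, and d ∈ ℂ, such that δ(z) = k·exp(c·z) + d for all z and a(λ) = exp(c·λ) for all λ ∈ Λ. -/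
/-- An entire function whose periods contain a lattice is constant. -/
theorem Differentiable.exists_const_of_lattice_periods {Λ : AddSubgroup ℂ}
    (hdisc : DiscreteTopology Λ) (hspan : Submodule.span ℝ (Λ : Set ℂ) = ⊤)
    {f : ℂ → ℂ} (hf : Differentiable ℂ f) (hper : ∀ z, ∀ lam ∈ Λ, f (z + lam) = f z) :
    ∃ c, ∀ z, f z = c := by
  let L : Submodule ℤ ℂ := AddSubgroup.toIntSubmodule Λ
  have : DiscreteTopology L := hdisc
  have : IsZLattice ℝ L := ⟨hspan⟩
  have hcompact : IsCompact (Set.range f) :=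
    IsZLattice.isCompact_range_of_periodic L f hf.continuous fun z w hw => hper z w hw
  exact hf.exists_const_forall_eq_of_bounded hcompact.isBounded

/-- An entire function with `g' = c g` is a multiple of `exp (c z)`. -/
theorem Complex.eq_mul_exp_of_deriv_eq_mul {g : ℂ → ℂ} {c : ℂ} (hg : Differentiable ℂ g)
    (h : ∀ z, deriv g z = c * g z) (z : ℂ) : g z = g 0 * Complex.exp (c * z) := by
  have hder : ∀ w, HasDerivAt (fun w => g w * Complex.exp (-(c * w))) 0 w := fun w => by
    have he : HasDerivAt (fun w => Complex.exp (-(c * w))) (Complex.exp (-(c * w)) * -(c * 1)) w :=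
      ((hasDerivAt_id w).const_mul c).neg.cexp
    have hp := (hg w).hasDerivAt.mul he
    rw [h] at hp
    exact hp.congr_deriv (by ring)
  have hconst := is_const_of_deriv_eq_zero (fun w => (hder w).differentiableAt)
    (fun w => (hder w).deriv) z 0
  simp only [mul_zero, neg_zero, Complex.exp_zero, mul_one] at hconst
  rw [← hconst, mul_assoc, ← Complex.exp_add, neg_add_cancel, Complex.exp_zero, mul_one]

/-- classification of holomorphic affine structures on elliptic
curves: a holomorphic `δ` with nowhere-vanishing derivative, equivariant by
affine maps `z ↦ a λ * z + t λ` over a lattice `Λ`, is either affine-linear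
with trivial linear holonomy, or of the form `k exp (c z) + d` with holonomy
multipliers `exp (c λ)` — and exactly one of these alternatives holds. -/
theorem stmt_5
    (Λ : AddSubgroup ℂ)
    (hdisc : DiscreteTopology Λ)
    (hspan : Submodule.span ℝ (Λ : Set ℂ) = ⊤)
    (δ : ℂ → ℂ)
    (hδ : Differentiable ℂ δ)
    (hδ' : ∀ z : ℂ, deriv δ z ≠ 0)
    (a t : ℂ → ℂ)
    (ha : ∀ lam ∈ Λ, a lam ≠ 0)
    (hper : ∀ z : ℂ, ∀ lam ∈ Λ, δ (z + lam) = a lam * δ z + t lam) :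
    Xor'
      (∃ α β : ℂ, α ≠ 0 ∧ (∀ z : ℂ, δ z = α * z + β) ∧ ∀ lam ∈ Λ, a lam = 1)
      (∃ k c d : ℂ, k ≠ 0 ∧ c ≠ 0 ∧
        (∀ z : ℂ, δ z = k * Complex.exp (c * z) + d) ∧
        ∀ lam ∈ Λ, a lam = Complex.exp (c * lam)) := by
  have hδ₁ : Differentiable ℂ (deriv δ) := hδ.deriv
  have hper₁ : ∀ z, ∀ lam ∈ Λ, deriv δ (z + lam) = a lam * deriv δ z := fun z lam hlam => by
    rw [← deriv_comp_add_const, funext fun w => hper w lam hlam, deriv_add_const,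
      deriv_const_mul _ (hδ z)]
  have hper₂ : ∀ z, ∀ lam ∈ Λ, deriv (deriv δ) (z + lam) = a lam * deriv (deriv δ) z :=
    fun z lam hlam => by
      rw [← deriv_comp_add_const, funext fun w => hper₁ w lam hlam, deriv_const_mul _ (hδ₁ z)]
  obtain ⟨c, hc⟩ : ∃ c, ∀ z, deriv (deriv δ) z / deriv δ z = c := by
    refine Differentiable.exists_const_of_lattice_periods hdisc hspan
      (hδ₁.deriv.div hδ₁ hδ') fun z lam hlam => ?_
    rw [hper₁ z lam hlam, hper₂ z lam hlam, mul_div_mul_left _ _ (ha lam hlam)]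
  have hexp : ∀ z, deriv δ z = deriv δ 0 * Complex.exp (c * z) :=
    Complex.eq_mul_exp_of_deriv_eq_mul hδ₁ fun z => (div_eq_iff (hδ' z)).mp (hc z)
  have ha' : ∀ lam ∈ Λ, a lam = Complex.exp (c * lam) := fun lam hlam => by
    have h := hper₁ 0 lam hlam
    rw [zero_add, hexp lam, mul_comm] at h
    exact (mul_right_cancel₀ (hδ' 0) h).symm
  refine (xor_iff_or_and_not_and _ _).mpr ?_
  refine ⟨?_, ?_⟩
  · by_cases hc0 : c = 0
    · subst hc0
      left
      refine ⟨deriv δ 0, δ 0, hδ' 0, fun z => ?_, fun lam hlam => by simpa using ha' lam hlam⟩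
      have hder : ∀ w, HasDerivAt (fun w => δ w - deriv δ 0 * w) 0 w := fun w => by
        have h := (hδ w).hasDerivAt.sub ((hasDerivAt_id w).const_mul (deriv δ 0))
        rw [hexp w] at h
        exact h.congr_deriv (by simp)
      have h := is_const_of_deriv_eq_zero (fun w => (hder w).differentiableAt)
        (fun w => (hder w).deriv) z 0
      simp only [mul_zero, sub_zero] at h
      linear_combination h
    · right
      refine ⟨deriv δ 0 / c, c, δ 0 - deriv δ 0 / c, div_ne_zero (hδ' 0) hc0, hc0,
        fun z => ?_, ha'⟩
      have hder : ∀ w, HasDerivAt (fun w => δ w - deriv δ 0 / c * Complex.exp (c * w)) 0 w :=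
        fun w => by
          have h := (hδ w).hasDerivAt.sub
            (((hasDerivAt_id w).const_mul c).cexp.const_mul (deriv δ 0 / c))
          rw [hexp w] at h
          refine h.congr_deriv ?_
          simp only [id]
          field_simp
          ring
      have h := is_const_of_deriv_eq_zero (fun w => (hder w).differentiableAt)
        (fun w => (hder w).deriv) z 0
      simp only [mul_zero, Complex.exp_zero, mul_one] at h
      linear_combination h
  · rintro ⟨⟨α, β, -, hlin, -⟩, k, b, d, hk, hb, hδexp, -⟩
    have h₀ := (hlin 0).symm.trans (hδexp 0)
    have h₁ := (hlin (1 / b)).symm.trans (hδexp (1 / b))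
    have h₂ := (hlin (2 / b)).symm.trans (hδexp (2 / b))
    have e₁ : b * (1 / b) = 1 := by field_simp
    have e₂ : b * (2 / b) = 1 + 1 := by field_simp; norm_num
    rw [mul_zero, mul_zero, Complex.exp_zero] at h₀
    rw [e₁] at h₁
    rw [e₂, Complex.exp_add] at h₂
    have hsq : k * (Complex.exp 1 - 1) ^ 2 = 0 := by
      linear_combination 2 * h₁ - h₂ - h₀
    have hone : Complex.exp 1 = 1 := by
      simpa [hk, sub_eq_zero] using hsq
    have : Real.exp 1 = 1 := Complex.ofReal_injective (by simpa using hone)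
    simp at this
end

section
/- Let d ∈ SL(2,ℂ) be the diagonal matrix with entries i and −i, let s ∈ SL(2,ℂ) be the matrix with rows (0, i) and (i, 0), and let Q = {I, −I, d, −d, s, −s, d·s, −d·s}, an eight-element subgroup of SL(2,ℂ). Then the normalizer N = {g ∈ SL(2,ℂ) : g·Q·g⁻¹ = Q} is a finite subgroup of SL(2,ℂ) with exactly 48 elements. (Equivalently: the normalizer in PSL(2,ℂ) of the Klein four-group generated by the classes of d and s is the 24-element rotation group of the cube.) -/
open Matrix

/-- The matrix `q₀ + q₁ d + q₂ s + q₃ d s`: the complex quaternion with coordinates `q`. -/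
def quatMatrix (q : Fin 4 → ℂ) : Matrix (Fin 2) (Fin 2) ℂ :=
  !![q 0 + Complex.I * q 1, Complex.I * q 2 - q 3;
    Complex.I * q 2 + q 3, q 0 - Complex.I * q 1]

/-- The Euler–Rodrigues matrix of the quaternion with coordinates `q`, transposed: row `i` holds
the coordinates of `q eᵢ q̄`. -/
def rotationRows {A : Type*} [CommRing A] (q : Fin 4 → A) : Fin 3 → Fin 3 → A :=
  ![![q 0 ^ 2 + q 1 ^ 2 - q 2 ^ 2 - q 3 ^ 2, 2 * (q 1 * q 2 + q 0 * q 3),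
      2 * (q 1 * q 3 - q 0 * q 2)],
    ![2 * (q 1 * q 2 - q 0 * q 3), q 0 ^ 2 - q 1 ^ 2 + q 2 ^ 2 - q 3 ^ 2,
      2 * (q 2 * q 3 + q 0 * q 1)],
    ![2 * (q 1 * q 3 + q 0 * q 2), 2 * (q 2 * q 3 - q 0 * q 1),
      q 0 ^ 2 - q 1 ^ 2 - q 2 ^ 2 + q 3 ^ 2]]

/-- The sum of the squares of the coordinates. -/
def quatNorm {A : Type*} [CommRing A] (q : Fin 4 → A) : A :=
  q 0 ^ 2 + q 1 ^ 2 + q 2 ^ 2 + q 3 ^ 2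

/-- The vector `±eⱼ`, with the sign given by a Boolean. -/
def signedUnit {A : Type*} [CommRing A] (j : Fin 3) (b : Bool) : Fin 3 → A :=
  fun k => if k = j then (if b then 1 else -1) else 0

/-- The coordinates of the purely imaginary quaternion with imaginary part `v`. -/
def pureQuat (v : Fin 3 → ℂ) : Fin 4 → ℂ := ![0, v 0, v 1, v 2]

/-- The group `{±1, ±d, ±s, ±ds}`. -/
def quaternionGroupSet : Set (Matrix (Fin 2) (Fin 2) ℂ) :=
  {g | g = 1 ∨ g = -1 ∨ ∃ j b, g = quatMatrix (pureQuat (signedUnit j b))}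

lemma quatMatrix_injective : Function.Injective quatMatrix := by
  intro p q h
  have h00 := congrFun (congrFun h 0) 0
  have h01 := congrFun (congrFun h 0) 1
  have h10 := congrFun (congrFun h 1) 0
  have h11 := congrFun (congrFun h 1) 1
  simp [quatMatrix] at h00 h01 h10 h11
  have hI := Complex.I_mul_I
  ext i
  fin_cases i <;> simp
  · linear_combination (h00 + h11) / 2
  · linear_combination -Complex.I * (h00 - h11) / 2 + (p 1 - q 1) * hI
  · linear_combination -Complex.I * (h01 + h10) / 2 + (p 2 - q 2) * hI
  · linear_combination (h10 - h01) / 2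

lemma quatMatrix_surjective : Function.Surjective quatMatrix := by
  intro g
  have hI := Complex.I_mul_I
  refine ⟨![(g 0 0 + g 1 1) / 2, -Complex.I * (g 0 0 - g 1 1) / 2,
    -Complex.I * (g 0 1 + g 1 0) / 2, (g 1 0 - g 0 1) / 2], ?_⟩
  ext i j
  fin_cases i <;> fin_cases j <;> simp [quatMatrix]
  · linear_combination -(g 0 0 - g 1 1) / 2 * hI
  · linear_combination -(g 0 1 + g 1 0) / 2 * hI
  · linear_combination -(g 0 1 + g 1 0) / 2 * hI
  · linear_combination (g 0 0 - g 1 1) / 2 * hI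

lemma det_quatMatrix (q : Fin 4 → ℂ) : (quatMatrix q).det = quatNorm q := by
  simp only [quatMatrix, det_fin_two_of, quatNorm]
  linear_combination (-q 1 ^ 2 - q 2 ^ 2) * Complex.I_mul_I

lemma quatMatrix_conj (q : Fin 4 → ℂ) (hq : quatNorm q = 1) (v : Fin 3 → ℂ) :
    quatMatrix q * quatMatrix (pureQuat v) * (quatMatrix q)⁻¹ =
      quatMatrix (pureQuat (v ᵥ* of (rotationRows q))) := by
  have hI : Complex.I ^ 2 = -1 := Complex.I_sq
  have hI3 : Complex.I ^ 3 = -Complex.I := by rw [pow_succ, hI]; ring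
  rw [Matrix.inv_def, det_quatMatrix, hq, Ring.inverse_one, one_smul]
  ext i j
  fin_cases i <;> fin_cases j <;>
    simp [quatMatrix, pureQuat, rotationRows, adjugate_fin_two, Matrix.mul_apply,
      Fin.sum_univ_succ, vecMul, dotProduct] <;> ring_nf <;> simp only [hI, hI3] <;> ring

lemma signedUnit_vecMul_rotationRows (q : Fin 4 → ℂ) (i : Fin 3) (b : Bool) :
    (signedUnit i b : Fin 3 → ℂ) ᵥ* of (rotationRows q) =
      if b then rotationRows q i else -rotationRows q i := by
  ext k
  cases b <;> simp [signedUnit, vecMul, dotProduct]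

lemma neg_signedUnit {A : Type*} [CommRing A] (j : Fin 3) (b : Bool) :
    -(signedUnit j b : Fin 3 → A) = signedUnit j !b := by
  ext k
  by_cases h : k = j <;> cases b <;> simp [signedUnit, h]

lemma pureQuat_injective : Function.Injective pureQuat := by
  intro u v h
  ext k
  have := congrFun h k.succ
  fin_cases k <;> simpa [pureQuat] using this

lemma quatMatrix_one : quatMatrix ![1, 0, 0, 0] = 1 := by
  ext i j
  fin_cases i <;> fin_cases j <;> simp [quatMatrix]

lemma quatMatrix_neg_one : quatMatrix ![-1, 0, 0, 0] = -1 := by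
  ext i j
  fin_cases i <;> fin_cases j <;> simp [quatMatrix]

lemma quatMatrix_pureQuat_mem (v : Fin 3 → ℂ) :
    quatMatrix (pureQuat v) ∈ quaternionGroupSet ↔ ∃ j b, v = signedUnit j b := by
  constructor
  · rintro (h | h | ⟨j, b, h⟩)
    · rw [← quatMatrix_one] at h
      simpa [pureQuat] using congrFun (quatMatrix_injective h) 0
    · rw [← quatMatrix_neg_one] at h
      simpa [pureQuat] using congrFun (quatMatrix_injective h) 0
    · exact ⟨j, b, pureQuat_injective (quatMatrix_injective h)⟩
  · rintro ⟨j, b, rfl⟩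
    exact Or.inr (Or.inr ⟨j, b, rfl⟩)

lemma quaternionGroupSet_finite : quaternionGroupSet.Finite := by
  have : quaternionGroupSet ⊆ {1, -1} ∪ Set.range
      (fun x : Fin 3 × Bool => quatMatrix (pureQuat (signedUnit x.1 x.2))) := by
    rintro g (h | h | ⟨j, b, h⟩)
    · simp [h]
    · simp [h]
    · exact Or.inr ⟨(j, b), h.symm⟩
  exact ((Set.toFinite _).union (Set.finite_range _)).subset this

lemma normalizes_iff (q : Fin 4 → ℂ) (hq : quatNorm q = 1) :
    (fun x => quatMatrix q * x * (quatMatrix q)⁻¹) '' quaternionGroupSet = quaternionGroupSet ↔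
      ∀ i, ∃ j b, rotationRows q i = signedUnit j b := by
  have hu : IsUnit (quatMatrix q).det := by simp [det_quatMatrix, hq]
  constructor
  · intro h i
    have hmem : quatMatrix (pureQuat (signedUnit i true)) ∈ quaternionGroupSet :=
      (quatMatrix_pureQuat_mem _).2 ⟨i, true, rfl⟩
    have := h ▸ Set.mem_image_of_mem (fun x => quatMatrix q * x * (quatMatrix q)⁻¹) hmem
    simpa [quatMatrix_conj q hq, signedUnit_vecMul_rotationRows, quatMatrix_pureQuat_mem] using this
  · intro h
    have hinj : Function.Injective (fun x => quatMatrix q * x * (quatMatrix q)⁻¹) := by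
      intro x y hxy
      have := congrArg (fun z => (quatMatrix q)⁻¹ * z * quatMatrix q) hxy
      simpa [Matrix.mul_assoc, Matrix.nonsing_inv_mul _ hu,
        Matrix.nonsing_inv_mul_cancel_left _ _ hu] using this
    refine Set.eq_of_subset_of_ncard_le ?_ (Set.ncard_image_of_injective _ hinj).ge
      quaternionGroupSet_finite
    rintro _ ⟨x, rfl | rfl | ⟨i, b, rfl⟩, rfl⟩
    · left
      simp [Matrix.mul_nonsing_inv _ hu]
    · right; left
      simp [Matrix.mul_nonsing_inv _ hu]
    · obtain ⟨j, c, hj⟩ := h i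
      simp only [quatMatrix_conj q hq, signedUnit_vecMul_rotationRows, quatMatrix_pureQuat_mem, hj,
        neg_signedUnit]
      cases b
      · exact ⟨j, !c, by simp⟩
      · exact ⟨j, c, by simp⟩

lemma eq_or_eq_neg_of_mul_eq_mul {ι K : Type*} [Field K] {p q : ι → K}
    (h : ∀ i j, q i * q j = p i * p j) : q = p ∨ q = -p := by
  by_cases hp : p = 0
  · left
    ext i
    simpa [hp] using h i i
  · obtain ⟨i, hi⟩ := Function.ne_iff.1 hp
    rcases mul_self_eq_mul_self_iff.1 (h i i) with hq | hq
    · left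
      ext j
      have := h i j
      rw [hq] at this
      exact mul_left_cancel₀ hi this
    · right
      ext j
      have := h i j
      rw [hq] at this
      exact mul_left_cancel₀ hi (by simp only [Pi.neg_apply]; linear_combination -this)

lemma eq_or_eq_neg_of_rotationRows_eq {p q : Fin 4 → ℂ} (hn : quatNorm q = quatNorm p)
    (h : rotationRows q = rotationRows p) : q = p ∨ q = -p := by
  have H := fun i j => congrFun (congrFun h i) j
  have h00 := H 0 0
  have h01 := H 0 1
  have h02 := H 0 2
  have h10 := H 1 0
  have h11 := H 1 1
  have h12 := H 1 2
  have h20 := H 2 0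
  have h21 := H 2 1
  have h22 := H 2 2
  simp [rotationRows] at h00 h01 h02 h10 h11 h12 h20 h21 h22
  simp only [quatNorm] at hn
  apply eq_or_eq_neg_of_mul_eq_mul
  intro i j
  fin_cases i <;> fin_cases j <;> simp <;> grind

lemma det_rotationRows {A : Type*} [CommRing A] (q : Fin 4 → A) :
    (of (rotationRows q)).det = quatNorm q ^ 3 := by
  simp [det_fin_three, rotationRows, quatNorm]
  ring

/-- The sign vectors whose normalizations are the 48 units of the binary octahedral group. -/
def octahedralSigns : Finset (Fin 4 → SignType) :=
  {n | quatNorm (fun i => (n i : ℤ)) ∈ ({1, 2, 4} : Finset ℤ)}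

lemma card_octahedralSigns : octahedralSigns.card = 48 := by
  decide +kernel

lemma rotationRows_octahedralSigns : ∀ n ∈ octahedralSigns, ∀ i, ∃ j b,
    rotationRows (fun i => (n i : ℤ)) i = quatNorm (fun i => (n i : ℤ)) • signedUnit j b := by
  decide +kernel

lemma exists_octahedralSigns : ∀ (j : Fin 3 → Fin 3) (b : Fin 3 → Bool),
    (of fun i => (signedUnit (j i) (b i) : Fin 3 → ℤ)).det = 1 →
    ∃ n ∈ octahedralSigns, ∀ i, rotationRows (fun i => (n i : ℤ)) i =
      quatNorm (fun i => (n i : ℤ)) • signedUnit (j i) (b i) := by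
  simp only [det_fin_three, of_apply]
  decide +kernel

lemma quatNorm_smul_intCast (c : ℂ) (m : Fin 4 → ℤ) :
    quatNorm (fun i => c * m i) = c ^ 2 * (quatNorm m : ℤ) := by
  simp only [quatNorm]
  push_cast
  ring

lemma rotationRows_smul_intCast (c : ℂ) (m : Fin 4 → ℤ) (i k : Fin 3) :
    rotationRows (fun i => c * m i) i k = c ^ 2 * (rotationRows m i k : ℤ) := by
  fin_cases i <;> fin_cases k <;> simp [rotationRows] <;> ring

/-- The unit quaternion in the direction of a sign vector. -/
noncomputable def normalizedSigns (n : Fin 4 → SignType) : Fin 4 → ℂ :=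
  fun i => (((√(quatNorm (fun i => (n i : ℤ)) : ℤ))⁻¹ : ℝ) : ℂ) * (n i : ℤ)

lemma quatNorm_pos {n : Fin 4 → SignType} (hn : n ∈ octahedralSigns) :
    0 < quatNorm (fun i => (n i : ℤ)) := by
  simp only [octahedralSigns, Finset.mem_filter, Finset.mem_insert, Finset.mem_singleton] at hn
  omega

lemma inv_sqrt_quatNorm_sq {n : Fin 4 → SignType} (hn : n ∈ octahedralSigns) :
    (((√(quatNorm (fun i => (n i : ℤ)) : ℤ))⁻¹ : ℝ) : ℂ) ^ 2 *
      (quatNorm (fun i => (n i : ℤ)) : ℤ) = 1 := by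
  have h : (0 : ℝ) < (quatNorm (fun i => (n i : ℤ)) : ℤ) := by exact_mod_cast quatNorm_pos hn
  have : (√(quatNorm (fun i => (n i : ℤ)) : ℤ))⁻¹ ^ 2 *
      ((quatNorm (fun i => (n i : ℤ)) : ℤ) : ℝ) = 1 := by
    rw [inv_pow, Real.sq_sqrt h.le, inv_mul_cancel₀ h.ne']
  exact_mod_cast this

lemma quatNorm_normalizedSigns {n : Fin 4 → SignType} (hn : n ∈ octahedralSigns) :
    quatNorm (normalizedSigns n) = 1 := by
  unfold normalizedSigns
  rw [quatNorm_smul_intCast, inv_sqrt_quatNorm_sq hn]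

lemma rotationRows_normalizedSigns {n : Fin 4 → SignType} (hn : n ∈ octahedralSigns) {i j : Fin 3}
    {b : Bool} (h : rotationRows (fun i => (n i : ℤ)) i =
      quatNorm (fun i => (n i : ℤ)) • signedUnit j b) :
    rotationRows (normalizedSigns n) i = signedUnit j b := by
  ext k
  have h1 := inv_sqrt_quatNorm_sq hn
  have h2 : ((rotationRows (fun i => (n i : ℤ)) i k : ℤ) : ℂ) =
      (quatNorm (fun i => (n i : ℤ)) : ℤ) * signedUnit j b k := by
    rw [h]
    simp [signedUnit]
  unfold normalizedSigns
  rw [rotationRows_smul_intCast, h2, ← mul_assoc, h1, one_mul]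

lemma normalizedSigns_neg (n : Fin 4 → SignType) :
    normalizedSigns (-n) = -normalizedSigns n := by
  ext i
  simp [normalizedSigns, quatNorm]

lemma neg_mem_octahedralSigns {n : Fin 4 → SignType} (hn : n ∈ octahedralSigns) :
    -n ∈ octahedralSigns := by
  simpa [octahedralSigns, quatNorm] using hn

lemma normalizedSigns_injOn : Set.InjOn normalizedSigns octahedralSigns := by
  have key : ∀ n ∈ octahedralSigns, ∀ i, n i = SignType.sign (normalizedSigns n i).re := by
    intro n hn i
    have h : (0 : ℝ) < (quatNorm (fun i => (n i : ℤ)) : ℤ) := by exact_mod_cast quatNorm_pos hn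
    simp only [normalizedSigns, Complex.re_ofReal_mul, Complex.intCast_re, sign_mul,
      sign_pos (inv_pos.2 (Real.sqrt_pos.2 h)), one_mul]
    cases n i <;> simp
  intro m hm n hn h
  ext i
  rw [key m hm, key n hn, h]

lemma normalizer_eq_image :
    {g : Matrix (Fin 2) (Fin 2) ℂ | g.det = 1 ∧
      (fun x => g * x * g⁻¹) '' quaternionGroupSet = quaternionGroupSet} =
      (fun n => quatMatrix (normalizedSigns n)) '' octahedralSigns := by
  ext g
  obtain ⟨q, rfl⟩ := quatMatrix_surjective g
  simp only [Set.mem_ofPred_eq, det_quatMatrix, Set.mem_image, quatMatrix_injective.eq_iff,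
    SetLike.mem_coe]
  constructor
  · rintro ⟨hq, h⟩
    rw [normalizes_iff q hq] at h
    choose j b hjb using h
    have hdet : (of fun i => (signedUnit (j i) (b i) : Fin 3 → ℤ)).det = 1 := by
      have h1 := det_rotationRows q
      rw [hq, one_pow, funext hjb] at h1
      have h2 : (((of fun i => (signedUnit (j i) (b i) : Fin 3 → ℤ)).det : ℤ) : ℂ) = 1 := by
        rw [← h1, Int.cast_det]
        congr 1
        ext i k
        simp [signedUnit]
      exact_mod_cast h2
    obtain ⟨n, hn, hrot⟩ := exists_octahedralSigns j b hdet
    have hrows : rotationRows q = rotationRows (normalizedSigns n) := by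
      funext i
      rw [hjb, rotationRows_normalizedSigns hn (hrot i)]
    rcases eq_or_eq_neg_of_rotationRows_eq (hq.trans (quatNorm_normalizedSigns hn).symm) hrows
      with rfl | rfl
    · exact ⟨n, hn, rfl⟩
    · exact ⟨-n, neg_mem_octahedralSigns hn, normalizedSigns_neg n⟩
  · rintro ⟨n, hn, rfl⟩
    have hq := quatNorm_normalizedSigns hn
    refine ⟨hq, (normalizes_iff _ hq).2 fun i => ?_⟩
    obtain ⟨j, b, h⟩ := rotationRows_octahedralSigns n hn i
    exact ⟨j, b, rotationRows_normalizedSigns hn h⟩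

lemma quaternionGroupSet_eq :
    let d : Matrix (Fin 2) (Fin 2) ℂ := !![Complex.I, 0; 0, -Complex.I]
    let s : Matrix (Fin 2) (Fin 2) ℂ := !![0, Complex.I; Complex.I, 0]
    ({1, -1, d, -d, s, -s, d * s, -(d * s)} : Set (Matrix (Fin 2) (Fin 2) ℂ)) =
      quaternionGroupSet := by
  ext g
  simp only [quaternionGroupSet, Set.mem_insert_iff, Set.mem_singleton_iff, Set.mem_ofPred_eq,
    Fin.exists_fin_succ, Bool.exists_bool]
  simp [quatMatrix, pureQuat, signedUnit]
  tauto

/-- with `d = diag (i, -i)`, `s = !![0, i; i, 0]` and `Q` the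
eight-element quaternion-like subgroup `{±I, ±d, ±s, ±ds}` of `SL(2,ℂ)`, the
normalizer `N = {g ∈ SL(2,ℂ) : g Q g⁻¹ = Q}` is finite with exactly 48
elements (its image in `PSL(2,ℂ)` is the 24-element rotation group of the
cube). -/
theorem stmt_11 :
    let d : Matrix (Fin 2) (Fin 2) ℂ := !![Complex.I, 0; 0, -Complex.I]
    let s : Matrix (Fin 2) (Fin 2) ℂ := !![0, Complex.I; Complex.I, 0]
    let Q : Set (Matrix (Fin 2) (Fin 2) ℂ) :=
      {1, -1, d, -d, s, -s, d * s, -(d * s)}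
    let N : Set (Matrix (Fin 2) (Fin 2) ℂ) :=
      {g | g.det = 1 ∧ (fun q => g * q * g⁻¹) '' Q = Q}
    N.Finite ∧ N.ncard = 48 := by
  intro d s Q N
  have hN : N = (fun n => quatMatrix (normalizedSigns n)) '' octahedralSigns := by
    rw [← normalizer_eq_image, ← quaternionGroupSet_eq]
  rw [hN]
  refine ⟨octahedralSigns.finite_toSet.image _, ?_⟩
  have hinj : Set.InjOn (fun n => quatMatrix (normalizedSigns n)) octahedralSigns :=
    quatMatrix_injective.comp_injOn normalizedSigns_injOn
  rw [hinj.ncard_image, Set.ncard_coe_finset, card_octahedralSigns]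
end

section
/- Let Γ ⊆ ℂ be a nontrivial additive subgroup, and for t ∈ ℂ write U(t) ∈ SL(2,ℂ) for the matrix with rows (1, t) and (0, 1). Then a matrix g ∈ SL(2,ℂ) satisfies both g·U(t)·g⁻¹ ∈ {±U(s) : s ∈ Γ} for every t ∈ Γ and g⁻¹·U(t)·g ∈ {±U(s) : s ∈ Γ} for every t ∈ Γ, if and only if the (2,1) entry of g is 0 and the (1,1) entry a of g satisfies a²·Γ = Γ. (Equivalently: the normalizer in PSL(2,ℂ) of the image of {U(t) : t ∈ Γ} is the set of classes of upper triangular matrices with rows (a, b) and (0, a⁻¹) such that a²·Γ = Γ.) -/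
/-- Conjugating a unipotent upper triangular matrix by a matrix of determinant one. -/
theorem conj_unipotent {a b c d : ℂ} (h : a * d - b * c = 1) (t : ℂ) :
    !![a, b; c, d] * !![1, t; 0, 1] * !![d, -b; -c, a] =
      !![1 - a * c * t, a ^ 2 * t; -(c ^ 2 * t), 1 + a * c * t] := by
  ext i j
  fin_cases i <;> fin_cases j <;> simp [Matrix.mul_apply, Fin.sum_univ_two]
  · linear_combination h
  · ring
  · ring
  · linear_combination h

/-- If a unipotent conjugate of a nontrivial unipotent is `± U s`, the conjugator is upper
triangular. -/
theorem eq_zero_of_conj_eq {a c t s : ℂ} (ht : t ≠ 0)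
    (h : !![1 - a * c * t, a ^ 2 * t; -(c ^ 2 * t), 1 + a * c * t] = !![1, s; 0, 1] ∨
      !![1 - a * c * t, a ^ 2 * t; -(c ^ 2 * t), 1 + a * c * t] = -!![1, s; 0, 1]) :
    c = 0 := by
  have h' : c ^ 2 * t = 0 := by
    rcases h with h | h <;> simpa using congrFun (congrFun h 1) 0
  simpa [ht] using h'

/-- for a nontrivial additive subgroup `Γ ⊆ ℂ` and
`U t = !![1, t; 0, 1]`, a determinant-one matrix `g` normalizes (in
`PSL(2,ℂ)`) the image of `{U t : t ∈ Γ}` — i.e. both `g (U t) g⁻¹` and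
`g⁻¹ (U t) g` lie in `{± U s : s ∈ Γ}` for all `t ∈ Γ` — if and only if
`g` is upper triangular (`g 1 0 = 0`) and its top-left entry `a` satisfies
`a² Γ = Γ`. -/
theorem stmt_12
    (Γ : AddSubgroup ℂ) (hΓ : Γ ≠ ⊥)
    (g : Matrix (Fin 2) (Fin 2) ℂ) (hg : g.det = 1) :
    ((∀ t ∈ Γ, ∃ s ∈ Γ,
        g * !![1, t; 0, 1] * g⁻¹ = !![1, s; 0, 1] ∨
        g * !![1, t; 0, 1] * g⁻¹ = -!![1, s; 0, 1]) ∧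
     (∀ t ∈ Γ, ∃ s ∈ Γ,
        g⁻¹ * !![1, t; 0, 1] * g = !![1, s; 0, 1] ∨
        g⁻¹ * !![1, t; 0, 1] * g = -!![1, s; 0, 1])) ↔
    (g 1 0 = 0 ∧ (fun x => (g 0 0) ^ 2 * x) '' (Γ : Set ℂ) = (Γ : Set ℂ)) := by
  obtain ⟨a, b, c, d, rfl⟩ : ∃ a b c d, g = !![a, b; c, d] :=
    ⟨_, _, _, _, Matrix.eta_fin_two g⟩
  rw [Matrix.det_fin_two_of] at hg
  have hinv : (!![a, b; c, d] : Matrix (Fin 2) (Fin 2) ℂ)⁻¹ = !![d, -b; -c, a] := by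
    simp [Matrix.inv_def, Matrix.adjugate_fin_two_of, hg]
  have hconj (t : ℂ) := conj_unipotent hg t
  have hconj' (t : ℂ) : !![d, -b; -c, a] * !![1, t; 0, 1] * !![a, b; c, d] =
      !![1 - d * -c * t, d ^ 2 * t; -((-c) ^ 2 * t), 1 + d * -c * t] := by
    simpa using conj_unipotent (a := d) (b := -b) (c := -c) (d := a)
      (by linear_combination hg) t
  simp only [hinv, hconj, hconj']
  simp only [Matrix.of_apply, Matrix.cons_val_zero, Matrix.cons_val_one]
  have key (hc : c = 0) :
      ((∀ t ∈ Γ, a ^ 2 * t ∈ Γ) ∧ (∀ t ∈ Γ, d ^ 2 * t ∈ Γ)) ↔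
        (fun x => a ^ 2 * x) '' (Γ : Set ℂ) = (Γ : Set ℂ) := by
    have had : a ^ 2 * d ^ 2 = 1 := by
      rw [← mul_pow, show a * d = 1 by simpa [hc] using hg, one_pow]
    constructor
    · rintro ⟨h₁, h₂⟩
      refine Set.Subset.antisymm (Set.image_subset_iff.2 h₁) fun t ht =>
        ⟨d ^ 2 * t, h₂ t ht, ?_⟩
      linear_combination t * had
    · intro h
      refine ⟨fun t ht => h.subset ⟨t, ht, rfl⟩, fun t ht => ?_⟩
      obtain ⟨x, hx, rfl⟩ := h.superset ht
      rwa [show d ^ 2 * (a ^ 2 * x) = x by linear_combination x * had]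
  have hne : (1 : ℂ) ≠ -1 := by norm_num
  constructor
  · intro h
    obtain ⟨t, ht, ht0⟩ := Γ.bot_or_exists_ne_zero.resolve_left hΓ
    obtain ⟨s, -, hs⟩ := h.1 t ht
    have hc := eq_zero_of_conj_eq ht0 hs
    refine ⟨hc, (key hc).1 ?_⟩
    simpa [hc, hne] using h
  · rintro ⟨hc, h⟩
    simpa [hc, hne] using (key hc).2 h
end

section
/- Let f : ℂ → ℂ be holomorphic on ℂ ∖ {0} (differentiable over ℂ at every nonzero point), injective on ℂ ∖ {0}, and with image f(ℂ ∖ {0}) = ℂ ∖ {0}. Then there exists c ∈ ℂ, c ≠ 0, such that either f(z) = c·z for all z ≠ 0, or f(z) = c/z for all z ≠ 0. (Hence the biholomorphism group of ℂ× is ℂ× ⊔ ℂ×, and the only complex Lie groups acting faithfully on ℂ× are ℂ× and ℤ₂ ⋉ ℂ×.) -/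
open Filter Topology Metric

/-- A function that is holomorphic near a point but not at it, and stays away from some value,
is meromorphic at that point. -/
lemma MeromorphicAt.of_forall_le_norm_sub {f : ℂ → ℂ} {z₀ w : ℂ} {r : ℝ} (hr : 0 < r)
    (hd : ∀ᶠ z in 𝓝[≠] z₀, DifferentiableAt ℂ f z) (hw : ∀ᶠ z in 𝓝[≠] z₀, r ≤ ‖f z - w‖) :
    MeromorphicAt f z₀ := by
  set g : ℂ → ℂ := fun z => (f z - w)⁻¹ with hg
  have hgd : ∀ᶠ z in 𝓝[≠] z₀, DifferentiableAt ℂ g z := by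
    filter_upwards [hd, hw] with z h1 h2
    exact (h1.sub_const w).inv (norm_pos_iff.1 (hr.trans_le h2))
  have hb : IsBoundedUnder (· ≤ ·) (𝓝[≠] z₀) fun z => ‖g z - g z₀‖ := by
    refine isBoundedUnder_of_eventually_le (a := r⁻¹ + ‖g z₀‖) ?_
    filter_upwards [hw] with z h
    refine norm_sub_le_of_le ?_ le_rfl
    rw [hg, norm_inv]
    gcongr
  have hlim :=
    Complex.tendsto_limUnder_of_differentiable_on_punctured_nhds_of_bounded_under hgd hb
  have hup : AnalyticAt ℂ (Function.update g z₀ (limUnder (𝓝[≠] z₀) g)) z₀ := by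
    refine Complex.analyticAt_of_differentiable_on_punctured_nhds_of_continuousAt ?_
      (continuousAt_update_same.2 hlim)
    filter_upwards [hgd, self_mem_nhdsWithin] with z h hz
    exact h.congr_of_eventuallyEq
      ((eventually_ne_nhds hz).mono fun _ hy => Function.update_of_ne hy _ _)
  have hgm : MeromorphicAt g z₀ := hup.meromorphicAt.congr <| by
    filter_upwards [self_mem_nhdsWithin] with z hz
    exact Function.update_of_ne hz _ _
  exact (hgm.inv.add (MeromorphicAt.const w z₀)).congr <| .of_forall fun z => by simp [hg]

/-- An injective holomorphic function on the punctured plane is meromorphic at the origin. -/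
lemma meromorphicAt_zero_of_injOn {f : ℂ → ℂ} (hf : ∀ z : ℂ, z ≠ 0 → DifferentiableAt ℂ f z)
    (hinj : Set.InjOn f {z : ℂ | z ≠ 0}) : MeromorphicAt f 0 := by
  have hball : ∀ z ∈ ball (2 : ℂ) 1, z ≠ 0 := by
    rintro z hz rfl
    norm_num [mem_ball, dist_eq_norm] at hz
  have han : AnalyticAt ℂ f 2 := Complex.analyticAt_iff_eventually_differentiableAt.2 <| by
    filter_upwards [isOpen_ne.mem_nhds (two_ne_zero : (2 : ℂ) ≠ 0)] with z hz using hf z hz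
  have himg : f '' ball 2 1 ∈ 𝓝 (f 2) := by
    rcases han.eventually_constant_or_nhds_le_map_nhds with h | h
    · have h' : ∀ᶠ z in 𝓝[≠] (2 : ℂ), False := by
        filter_upwards [nhdsWithin_le_nhds h, self_mem_nhdsWithin,
          nhdsWithin_le_nhds (isOpen_ne.mem_nhds (two_ne_zero : (2 : ℂ) ≠ 0))] with z h1 h2 h3
        exact h2 (hinj h3 (two_ne_zero : (2 : ℂ) ≠ 0) h1)
      exact absurd h' (by simp [NeBot.ne])
    · exact h (image_mem_map (ball_mem_nhds _ one_pos))
  obtain ⟨r, hr, hrb⟩ := Metric.mem_nhds_iff.1 himg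
  refine .of_forall_le_norm_sub hr (eventually_mem_nhdsWithin.mono hf) (w := f 2) ?_
  filter_upwards [self_mem_nhdsWithin, nhdsWithin_le_nhds (ball_mem_nhds (0 : ℂ) one_pos)]
    with z hz hz1
  by_contra! h
  obtain ⟨y, hy, hyz⟩ := hrb (mem_ball_iff_norm.2 h)
  obtain rfl := hinj (hball y hy) hz hyz
  have h2 : dist (2 : ℂ) 0 < 1 + 1 :=
    (dist_triangle_left _ _ y).trans_lt (add_lt_add (mem_ball.1 hy) (mem_ball.1 hz1))
  norm_num at h2

/-- An injective nowhere vanishing holomorphic function on the punctured plane is asymptotic to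
a multiple of an integer power at the origin. -/
lemma exists_tendsto_mul_zpow_of_injOn {f : ℂ → ℂ}
    (hf : ∀ z : ℂ, z ≠ 0 → DifferentiableAt ℂ f z) (hinj : Set.InjOn f {z : ℂ | z ≠ 0})
    (hne : ∀ z : ℂ, z ≠ 0 → f z ≠ 0) :
    ∃ n : ℤ, ∃ a : ℂ, a ≠ 0 ∧ Tendsto (fun z => f z * z ^ n) (𝓝[≠] 0) (𝓝 a) := by
  have hm := meromorphicAt_zero_of_injOn hf hinj
  have htop : meromorphicOrderAt f 0 ≠ ⊤ :=
    (meromorphicOrderAt_ne_top_iff_eventually_ne_zero hm).2 (eventually_mem_nhdsWithin.mono hne)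
  obtain ⟨g, hg, hg0, hfg⟩ := (meromorphicOrderAt_ne_top_iff hm).1 htop
  refine ⟨-(meromorphicOrderAt f 0).untop₀, g 0, hg0,
    (hg.continuousAt.tendsto.mono_left nhdsWithin_le_nhds).congr' ?_⟩
  filter_upwards [hfg, self_mem_nhdsWithin] with z hz hz0
  have hz0 : z ≠ 0 := hz0
  rw [hz, sub_zero, smul_eq_mul, zpow_neg]
  field_simp

lemma tendsto_zpow_cobounded_of_neg {n : ℤ} (hn : n < 0) :
    Tendsto (fun z : ℂ => z ^ n) (Bornology.cobounded ℂ) (𝓝 0) := by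
  obtain ⟨k, rfl⟩ : ∃ k : ℕ, n = -k := ⟨n.natAbs, by omega⟩
  have hk : k ≠ 0 := by omega
  simpa [hk] using (tendsto_inv₀_cobounded (α := ℂ)).pow k

/-- A nowhere vanishing entire function asymptotic to a multiple of an integer power at infinity
is constant. -/
lemma Differentiable.exists_eq_const_of_tendsto_mul_zpow {h : ℂ → ℂ} (hd : Differentiable ℂ h)
    (hne : ∀ z, h z ≠ 0) {k : ℤ} {b : ℂ} (hb : b ≠ 0)
    (hlim : Tendsto (fun z => h z * z ^ k) (Bornology.cobounded ℂ) (𝓝 b)) :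
    ∃ c, ∀ z, h z = c := by
  have hev : ∀ᶠ z : ℂ in Bornology.cobounded ℂ, z ≠ 0 := Bornology.eventually_ne_cobounded 0
  rcases lt_trichotomy k 0 with hk | rfl | hk
  · have h0 : Tendsto (fun z => (h z)⁻¹) (Bornology.cobounded ℂ) (𝓝 0) := by
      have := (hlim.inv₀ hb).mul (tendsto_zpow_cobounded_of_neg hk)
      rw [mul_zero] at this
      refine this.congr' (hev.mono fun z hz => ?_)
      field_simp
    rw [Metric.cobounded_eq_cocompact] at h0
    exact absurd ((hd.inv hne).apply_eq_of_tendsto_cocompact 0 h0) (inv_ne_zero (hne 0))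
  · simp only [zpow_zero, mul_one, Metric.cobounded_eq_cocompact] at hlim
    exact ⟨b, fun z => hd.apply_eq_of_tendsto_cocompact z hlim⟩
  · have h0 : Tendsto h (Bornology.cobounded ℂ) (𝓝 0) := by
      have := hlim.mul (tendsto_zpow_cobounded_of_neg (neg_lt_zero.2 hk))
      rw [mul_zero] at this
      refine this.congr' (hev.mono fun z hz => ?_)
      rw [zpow_neg]
      field_simp
    rw [Metric.cobounded_eq_cocompact] at h0
    exact absurd (hd.apply_eq_of_tendsto_cocompact 0 h0) (hne 0)

/-- An injective nowhere vanishing holomorphic function on the punctured plane is a multiple of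
an integer power. -/
lemma exists_eq_mul_zpow_of_injOn {f : ℂ → ℂ} (hf : ∀ z : ℂ, z ≠ 0 → DifferentiableAt ℂ f z)
    (hinj : Set.InjOn f {z : ℂ | z ≠ 0}) (hne : ∀ z : ℂ, z ≠ 0 → f z ≠ 0) :
    ∃ c : ℂ, ∃ n : ℤ, ∀ z : ℂ, z ≠ 0 → f z = c * z ^ n := by
  obtain ⟨n, a, ha, hlim⟩ := exists_tendsto_mul_zpow_of_injOn hf hinj hne
  obtain ⟨m, b, hb, hlim'⟩ := exists_tendsto_mul_zpow_of_injOn (f := fun z => f z⁻¹)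
    (fun z hz => (hf _ (inv_ne_zero hz)).comp z (differentiableAt_inv hz))
    (fun x hx y hy hxy => inv_injective (hinj (inv_ne_zero hx) (inv_ne_zero hy) hxy))
    (fun z hz => hne _ (inv_ne_zero hz))
  set h : ℂ → ℂ := Function.update (fun z => f z * z ^ n) 0 a with hh
  have hof : ∀ z : ℂ, z ≠ 0 → h z = f z * z ^ n := fun z hz => Function.update_of_ne hz _ _
  have hd : Differentiable ℂ h := by
    rw [← differentiableOn_univ,
      ← Complex.differentiableOn_compl_singleton_and_continuousAt_iff (c := 0) univ_mem]
    refine ⟨fun z hz => ?_, continuousAt_update_same.2 hlim⟩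
    have hz : z ≠ 0 := hz.2
    exact (((hf z hz).mul (differentiableAt_zpow.2 (.inl hz))).congr_of_eventuallyEq
      ((eventually_ne_nhds hz).mono fun _ hy => Function.update_of_ne hy _ _)
      ).differentiableWithinAt
  have hne' : ∀ z, h z ≠ 0 := fun z => by
    rcases eq_or_ne z 0 with rfl | hz
    · simpa [hh] using ha
    · rw [hof z hz]
      exact mul_ne_zero (hne z hz) (zpow_ne_zero _ hz)
  have hlim_infty : Tendsto (fun z => h z * z ^ (-n - m)) (Bornology.cobounded ℂ) (𝓝 b) := by
    refine (hlim'.comp (tendsto_inv₀_cobounded' (α := ℂ))).congr' ?_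
    filter_upwards [Bornology.eventually_ne_cobounded (0 : ℂ)] with z hz
    have hnm : n + (-n - m) = -m := by ring
    rw [hof z hz, mul_assoc, ← zpow_add₀ hz, hnm]
    simp
  obtain ⟨c, hc⟩ := hd.exists_eq_const_of_tendsto_mul_zpow hne' hb hlim_infty
  refine ⟨c, -n, fun z hz => ?_⟩
  rw [← hc z, hof z hz, mul_assoc, ← zpow_add₀ hz]
  simp

/-- The only injective integer powers on the punctured plane are the identity and inversion. -/
lemma natAbs_eq_one_of_injOn_zpow {n : ℤ}
    (hinj : Set.InjOn (fun z : ℂ => z ^ n) {z : ℂ | z ≠ 0}) : n.natAbs = 1 := by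
  rcases eq_or_ne n.natAbs 0 with h0 | h0
  · obtain rfl := Int.natAbs_eq_zero.1 h0
    exact absurd (hinj (one_ne_zero : (1 : ℂ) ≠ 0) (two_ne_zero : (2 : ℂ) ≠ 0) (by simp))
      (by norm_num)
  · have hp := Complex.isPrimitiveRoot_exp n.natAbs h0
    have hz : Complex.exp (2 * Real.pi * Complex.I / n.natAbs) ^ n = 1 :=
      (hp.zpow_eq_one_iff_dvd n).2 (Int.natAbs_dvd.2 dvd_rfl)
    have h1 := hinj (hp.ne_zero h0) (one_ne_zero : (1 : ℂ) ≠ 0) (by simpa using hz)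
    rw [h1] at hp
    exact hp.unique IsPrimitiveRoot.one

/-- every biholomorphism of the punctured plane `ℂ× = ℂ \ {0}`
is of the form `z ↦ c z` or `z ↦ c / z` with `c ≠ 0`. -/
theorem stmt_14
    (f : ℂ → ℂ)
    (hf : ∀ z : ℂ, z ≠ 0 → DifferentiableAt ℂ f z)
    (hinj : Set.InjOn f {z : ℂ | z ≠ 0})
    (himg : f '' {z : ℂ | z ≠ 0} = {z : ℂ | z ≠ 0}) :
    ∃ c : ℂ, c ≠ 0 ∧
      ((∀ z : ℂ, z ≠ 0 → f z = c * z) ∨ (∀ z : ℂ, z ≠ 0 → f z = c / z)) := by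
  have hne : ∀ z : ℂ, z ≠ 0 → f z ≠ 0 := fun z hz => himg.subset (Set.mem_image_of_mem f hz)
  obtain ⟨c, n, hcn⟩ := exists_eq_mul_zpow_of_injOn hf hinj hne
  have hn : n.natAbs = 1 := natAbs_eq_one_of_injOn_zpow fun x hx y hy hxy => hinj hx hy <| by
    rw [hcn x hx, hcn y hy]
    exact congrArg (c * ·) hxy
  refine ⟨c, fun hc => hne 1 one_ne_zero (by simp [hcn, hc]), ?_⟩
  rcases Int.natAbs_eq_iff.1 hn with rfl | rfl
  · exact .inl fun z hz => by simpa using hcn z hz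
  · exact .inr fun z hz => by simpa [div_eq_mul_inv] using hcn z hz
end
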